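/- arXiv:2212.09876 — 2 statements merged into one kernel-verified Lean document; each statement's English description precedes it below -/
import Mathlib

section
/- Let k ≥ 3 be a natural number and let D be an oriented graph with minimum semidegree at least (3k-2)/4. Then D contains every antidirected path of length k. -/
/-- Out-degree of `v` in the digraph given by the edge relation `D`. -/
noncomputable def outDeg {V : Type*} (D : V → V → Prop) (v : V) : ℕ := {w | D v w}.ncard

/-- In-degree of `v` in the digraph given by the edge relation `D`. -/
noncomputable def inDeg {V : Type*} (D : V → V → Prop) (v : V) : ℕ := {w | D w v}.ncard

/-- `D` is an oriented graph: for each pair of vertices, at most one of the edges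
`uv`, `vu` is present (in particular there are no loops). -/
def IsOriented {V : Type*} (D : V → V → Prop) : Prop := ∀ u v, D u v → ¬ D v u

/-- The number of (directed) edges of the digraph `D`. -/
noncomputable def edgeCount {V : Type*} (D : V → V → Prop) : ℕ := {p : V × V | D p.1 p.2}.ncard

/-- The minimum pseudo-semidegree of `D` is at least `x`: `D` has an edge, and every
vertex has out-degree `0` or at least `x`, and in-degree `0` or at least `x`. -/
def PseudoGE {V : Type*} (D : V → V → Prop) (x : ℝ) : Prop :=
  (∃ u v, D u v) ∧
    ∀ v, (outDeg D v = 0 ∨ x ≤ (outDeg D v : ℝ)) ∧ (inDeg D v = 0 ∨ x ≤ (inDeg D v : ℝ))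

/-- The minimum pseudo-semidegree of `D` is strictly greater than `x`. -/
def PseudoGT {V : Type*} (D : V → V → Prop) (x : ℝ) : Prop :=
  (∃ u v, D u v) ∧
    ∀ v, (outDeg D v = 0 ∨ x < (outDeg D v : ℝ)) ∧ (inDeg D v = 0 ∨ x < (inDeg D v : ℝ))

/-- `f, g` describe an antidirected path `f 0, f 1, ..., f m` (of length `m`) in `D`:
`g i = true` iff the `i`-th edge is directed from `f i` towards `f (i+1)`, and consecutive
edges alternate in direction (equivalently, every vertex of the path has out-degree `0`
or in-degree `0` on the path). -/
def IsAntipath {V : Type*} (D : V → V → Prop) (m : ℕ) (f : ℕ → V) (g : ℕ → Bool) : Prop :=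
  Set.InjOn f (Set.Iic m) ∧
  (∀ i < m, if g i then D (f i) (f (i + 1)) else D (f (i + 1)) (f i)) ∧
  (∀ i, i + 1 < m → g i ≠ g (i + 1))

/-- `D` contains each of the (at most two) antidirected paths of length `k`:
for each initial direction `b` there is an antidirected path of length `k`
whose first edge has direction `b`. -/
def ContainsAllAntipaths {V : Type*} (D : V → V → Prop) (k : ℕ) : Prop :=
  ∀ b : Bool, ∃ f g, IsAntipath D k f g ∧ g 0 = b

/-- `f` describes an antidirected cycle of length `n` in `D`: the `i`-th edge joins
`f i` and `f (i+1)` and is directed from `f i` iff `g i = true`; every vertex `f i`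
has out-degree `0` on the cycle (i.e. `g i = false ∧ g (i-1) = true`) or in-degree `0`
on the cycle (i.e. `g i = true ∧ g (i-1) = false`). -/
def IsAnticycle {V : Type*} (D : V → V → Prop) (n : ℕ) [NeZero n] (f : ZMod n → V) : Prop :=
  3 ≤ n ∧ Function.Injective f ∧
  ∃ g : ZMod n → Bool,
    (∀ i, if g i then D (f i) (f (i + 1)) else D (f (i + 1)) (f i)) ∧
    (∀ i : ZMod n, (g i = false ∧ g (i - 1) = true) ∨ (g i = true ∧ g (i - 1) = false))

/-- An oriented graph all of whose in- and out-degrees are at least `(3k-2)/4`. -/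
def SemidegreeBound {V : Type*} [Fintype V] (E : V → V → Prop) (k : ℕ) : Prop :=
  IsOriented E ∧ 3 ≤ k ∧ (∀ v, 3 * k ≤ 4 * {w | E v w}.ncard + 2) ∧
    ∀ v, 3 * k ≤ 4 * {w | E w v}.ncard + 2

/-- `f 0, …, f m` is an antidirected path in which the even positions are the sources. -/
def IsSourcePath {V : Type*} (E : V → V → Prop) (m : ℕ) (f : ℕ → V) : Prop :=
  (∀ i j, i ≤ m → j ≤ m → f i = f j → i = j) ∧
    ∀ a b, a % 2 = 0 → b % 2 = 1 → a ≤ m → b ≤ m → (a + 1 = b ∨ b + 1 = a) → E (f a) (f b)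

/-- `c 0, …, c (2n-1)` is a closed antidirected walk without repeated vertices in which the
even positions are the sources. -/
def IsSourceCycle {V : Type*} (E : V → V → Prop) (n : ℕ) (c : ℕ → V) : Prop :=
  (∀ i j, i < 2 * n → j < 2 * n → c i = c j → i = j) ∧
    ∀ a b, a % 2 = 0 → b % 2 = 1 → a < 2 * n → b < 2 * n →
      (a + 1 = b ∨ b + 1 = a ∨ (a = 0 ∧ b + 1 = 2 * n)) → E (c a) (c b)

section

variable {V : Type*} {E : V → V → Prop} {n m k : ℕ} {f c : ℕ → V}

lemma SemidegreeBound.flip [Fintype V] (h : SemidegreeBound E k) :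
    SemidegreeBound (flip E) k :=
  ⟨fun u v huv hvu => h.1 u v hvu huv, h.2.1, h.2.2.2, h.2.2.1⟩

lemma IsSourcePath.reverse (h : IsSourcePath E m f) (hm : m % 2 = 1) :
    IsSourcePath (flip E) m (fun i => f (m - i)) := by
  refine ⟨fun i j hi hj hij => ?_, fun a b ha hb ham hbm hab => ?_⟩
  · have := h.1 _ _ (by omega) (by omega) hij
    omega
  · exact h.2 _ _ (by omega) (by omega) (by omega) (by omega) (by omega)

lemma IsSourcePath.mono (h : IsSourcePath E n f) (hm : m ≤ n) : IsSourcePath E m f :=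
  ⟨fun i j hi hj hij => h.1 _ _ (by omega) (by omega) hij,
    fun a b ha hb ham hbm hab => h.2 _ _ ha hb (by omega) (by omega) hab⟩

lemma IsSourcePath.tail (h : IsSourcePath E (m + 1) f) :
    IsSourcePath (flip E) m (fun i => f (i + 1)) := by
  refine ⟨fun i j hi hj hij => ?_, fun a b ha hb ham hbm hab => ?_⟩
  · have := h.1 _ _ (by omega) (by omega) hij
    omega
  · exact h.2 _ _ (by omega) (by omega) (by omega) (by omega) (by omega)

lemma IsSourcePath.cons {w : V} (h : IsSourcePath E m f) (hw : E (f 0) w)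
    (hwf : ∀ i ≤ m, f i ≠ w) :
    IsSourcePath (flip E) (m + 1) (fun i => if i = 0 then w else f (i - 1)) := by
  refine ⟨fun i j hi hj hij => ?_, fun a b ha hb ham hbm hab => ?_⟩
  · dsimp only at hij
    split_ifs at hij with h1 h2 h2
    · omega
    · exact absurd hij.symm (hwf _ (by omega))
    · exact absurd hij (hwf _ (by omega))
    · have := h.1 _ _ (by omega) (by omega) hij
      omega
  · simp only [flip]
    have hb0 : b ≠ 0 := by omega
    by_cases h0 : a = 0
    · obtain rfl : b = 1 := by omega
      simpa [h0] using hw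
    · simp only [h0, hb0, if_false]
      exact h.2 _ _ (by omega) (by omega) (by omega) (by omega) (by omega)

lemma IsSourcePath.reverse_even (h : IsSourcePath E m f) (hm : m % 2 = 0) :
    IsSourcePath E m (fun i => f (m - i)) := by
  refine ⟨fun i j hi hj hij => ?_, fun a b ha hb ham hbm hab => ?_⟩
  · have := h.1 _ _ (by omega) (by omega) hij
    omega
  · exact h.2 _ _ (by omega) (by omega) (by omega) (by omega) (by omega)

lemma IsSourceCycle.reverse (h : IsSourceCycle E n c) :
    IsSourceCycle (flip E) n (fun i => c (2 * n - 1 - i)) := by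
  refine ⟨fun i j hi hj hij => ?_, fun a b ha hb ham hbm hab => ?_⟩
  · have := h.1 _ _ (by omega) (by omega) hij
    omega
  · exact h.2 _ _ (by omega) (by omega) (by omega) (by omega) (by omega)

lemma IsSourceCycle.path (h : IsSourceCycle E n c) (hn : 1 ≤ n) :
    IsSourcePath E (2 * n - 1) c :=
  ⟨fun i j hi hj hij => h.1 _ _ (by omega) (by omega) hij,
    fun a b ha hb ham hbm hab => h.2 _ _ ha hb (by omega) (by omega) (by omega)⟩

/-- A cycle may be started at any of its sources. -/
lemma IsSourceCycle.rotate (h : IsSourceCycle E n c) {r : ℕ} (hr : r < n) :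
    ∃ c', IsSourceCycle E n c' ∧ c' 0 = c (2 * r) ∧ c' 1 = c (2 * r + 1) ∧
      (∀ i < n, ∃ j < n, c' (2 * i) = c (2 * j)) ∧
      (∀ i < n, ∃ j < n, c' (2 * i + 1) = c (2 * j + 1)) ∧
      (∀ j < n, ∃ i < n, c' (2 * i) = c (2 * j)) ∧
      (∀ i < 2 * n, ∃ j < 2 * n, c' i = c j) := by
  refine ⟨fun i => c (if i + 2 * r < 2 * n then i + 2 * r else i + 2 * r - 2 * n),
    ⟨fun i j hi hj hij => ?_, fun a b ha hb ham hbm hab => ?_⟩, ?_, ?_, ?_, ?_, ?_, ?_⟩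
  · have := h.1 _ _ (by split_ifs <;> omega) (by split_ifs <;> omega) hij
    split_ifs at this <;> omega
  · dsimp only
    split_ifs <;>
      exact h.2 _ _ (by omega) (by omega) (by omega) (by omega) (by omega)
  · dsimp only
    rw [if_pos (by omega), zero_add]
  · dsimp only
    rw [if_pos (by omega), add_comm]
  · intro i hi
    refine ⟨if i + r < n then i + r else i + r - n, by split_ifs <;> omega, ?_⟩
    dsimp only
    congr 1
    split_ifs <;> omega
  · intro i hi
    refine ⟨if i + r < n then i + r else i + r - n, by split_ifs <;> omega, ?_⟩
    dsimp only
    congr 1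
    split_ifs <;> omega
  · intro j hj
    refine ⟨if r ≤ j then j - r else j + n - r, by split_ifs <;> omega, ?_⟩
    dsimp only
    congr 1
    split_ifs <;> omega
  · intro i hi
    exact ⟨_, by split_ifs <;> omega, rfl⟩

/-- A source of a cycle with an out-neighbour off the cycle gives a longer path. -/
lemma IsSourceCycle.exists_path_cons (h : IsSourceCycle E n c) {r : ℕ} (hr : r < n) {w : V}
    (hw : E (c (2 * r)) w) (hwc : ∀ i < 2 * n, c i ≠ w) :
    ∃ f, IsSourcePath (flip E) (2 * n) f ∧ f 0 = w ∧ ∀ i, 1 ≤ i → i ≤ 2 * n →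
      ∃ j < 2 * n, f i = c j := by
  obtain ⟨c', hc', h0, -, -, -, -, himg⟩ := h.rotate hr
  have := (hc'.path (by omega)).cons (w := w) (by rwa [h0]) (fun i hi hiw => by
    obtain ⟨j, hj, hij⟩ := himg i (by omega)
    exact hwc j hj (hij ▸ hiw))
  rw [show 2 * n - 1 + 1 = 2 * n by omega] at this
  refine ⟨_, this, by simp, fun i hi hi' => ?_⟩
  obtain ⟨j, hj, hij⟩ := himg (i - 1) (by omega)
  exact ⟨j, hj, by simp [show i ≠ 0 by omega, hij]⟩

open Classical in
lemma ncard_le_card_filter_add [Finite V] {Q : V → Prop} {p q : ℕ → V} {a b : ℕ}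
    (h : ∀ w, Q w → (∃ i < a, p i = w) ∨ ∃ i < b, q i = w) :
    {w | Q w}.ncard ≤ ((Finset.range a).filter fun i => Q (p i)).card +
      ((Finset.range b).filter fun i => Q (q i)).card := by
  have hsub : {w | Q w} ⊆ ((((Finset.range a).filter fun i => Q (p i)).image p ∪
      ((Finset.range b).filter fun i => Q (q i)).image q : Finset V) : Set V) := by
    intro w hw
    simp only [Finset.coe_union, Finset.coe_image, Finset.coe_filter, Finset.mem_range,
      Set.mem_union, Set.mem_image, Set.mem_ofPred_eq]
    rcases h w hw with ⟨i, hi, rfl⟩ | ⟨i, hi, rfl⟩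
    · exact Or.inl ⟨i, ⟨hi, hw⟩, rfl⟩
    · exact Or.inr ⟨i, ⟨hi, hw⟩, rfl⟩
  calc _ ≤ _ := Set.ncard_le_ncard hsub (Finset.finite_toSet _)
    _ = _ := Set.ncard_coe_finset _
    _ ≤ _ := Finset.card_union_le _ _
    _ ≤ _ := Nat.add_le_add Finset.card_image_le Finset.card_image_le

lemma exists_of_lt_two_mul {i n : ℕ} (hi : i < 2 * n) :
    (∃ j < n, 2 * j = i) ∨ ∃ j < n, 2 * j + 1 = i := by
  rcases Nat.even_or_odd' i with ⟨j, hj | hj⟩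
  · exact Or.inl ⟨j, by omega, hj.symm⟩
  · exact Or.inr ⟨j, by omega, hj.symm⟩

open Classical in
lemma ncard_le_card_filter_even_add_odd [Finite V] {Q : V → Prop} {n : ℕ} {c : ℕ → V}
    (h : ∀ w, Q w → ∃ i < 2 * n, c i = w) :
    {w | Q w}.ncard ≤ ((Finset.range n).filter fun i => Q (c (2 * i))).card +
      ((Finset.range n).filter fun i => Q (c (2 * i + 1))).card := by
  refine ncard_le_card_filter_add (p := fun i => c (2 * i)) (q := fun i => c (2 * i + 1))
    fun w hw => ?_
  obtain ⟨i, hi, rfl⟩ := h w hw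
  rcases exists_of_lt_two_mul hi with ⟨j, hj, rfl⟩ | ⟨j, hj, rfl⟩
  · exact Or.inl ⟨j, hj, rfl⟩
  · exact Or.inr ⟨j, hj, rfl⟩

lemma card_filter_range_le (Q : ℕ → Prop) [DecidablePred Q] (n : ℕ) :
    ((Finset.range n).filter Q).card ≤ n := by
  simpa using Finset.card_filter_le (Finset.range n) Q

lemma card_filter_range_add_one_le {Q : ℕ → Prop} [DecidablePred Q] {n i : ℕ} (hi : i < n) (hQ : ¬ Q i) :
    ((Finset.range n).filter Q).card + 1 ≤ n := by
  have : ((Finset.range n).filter Q).card < (Finset.range n).card :=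
    Finset.card_lt_card (Finset.filter_ssubset.2 ⟨i, by simpa using hi, hQ⟩)
  simpa using this

open Classical in
lemma exists_of_lt_card_filter_add {Q R : ℕ → Prop} {n : ℕ}
    (h : n < ((Finset.range n).filter Q).card + ((Finset.range n).filter R).card) :
    ∃ i < n, Q i ∧ R i := by
  by_contra! hcon
  have hdisj : Disjoint ((Finset.range n).filter Q) ((Finset.range n).filter R) :=
    Finset.disjoint_filter.2 fun i hi hQ => hcon i (Finset.mem_range.1 hi) hQ
  rw [← Finset.card_union_of_disjoint hdisj, ← Finset.filter_or] at h
  exact absurd h (not_lt.2 (card_filter_range_le _ _))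

open Classical in
lemma two_mul_sum_card_filter_add_le {R : ℕ → ℕ → Prop} (hR : ∀ i j, R i j → ¬ R j i) (n : ℕ) :
    2 * ∑ i ∈ Finset.range n, ((Finset.range n).filter (R i)).card + n ≤ n * n := by
  have hswap : ∑ i ∈ Finset.range n, ((Finset.range n).filter (R i)).card =
      ∑ i ∈ Finset.range n, ((Finset.range n).filter fun j => R j i).card :=
    Finset.sum_card_bipartiteAbove_eq_sum_card_bipartiteBelow R
  have hle : ∑ i ∈ Finset.range n, (((Finset.range n).filter (R i)).card +
      ((Finset.range n).filter fun j => R j i).card + 1) ≤ ∑ _i ∈ Finset.range n, n := by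
    refine Finset.sum_le_sum fun i hi => ?_
    have hdisj : Disjoint ((Finset.range n).filter (R i))
        ((Finset.range n).filter fun j => R j i) :=
      Finset.disjoint_filter.2 fun j _ hij => hR i j hij
    rw [← Finset.card_union_of_disjoint hdisj, ← Finset.filter_or]
    refine card_filter_range_add_one_le (Finset.mem_range.1 hi) ?_
    rintro (h | h) <;> exact hR _ _ h h
  simp only [Finset.sum_add_distrib, Finset.sum_const, Finset.card_range, smul_eq_mul,
    mul_one] at hle
  omega

open Classical in
/-- If all out-degrees of an oriented graph on `n` vertices are at least `(n-1)/2`, then they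
are all equal to `(n-1)/2`. -/
lemma two_mul_card_filter_add_one_eq {R : ℕ → ℕ → Prop} (hR : ∀ i j, R i j → ¬ R j i) {n : ℕ}
    (h : ∀ i < n, n ≤ 2 * ((Finset.range n).filter (R i)).card + 1) {i : ℕ} (hi : i < n) :
    2 * ((Finset.range n).filter (R i)).card + 1 = n := by
  by_contra hne
  have hlt : ∑ _i ∈ Finset.range n, n <
      ∑ i ∈ Finset.range n, (2 * ((Finset.range n).filter (R i)).card + 1) :=
    Finset.sum_lt_sum (fun j hj => h j (Finset.mem_range.1 hj))
      ⟨i, Finset.mem_range.2 hi, lt_of_le_of_ne (h i hi) (Ne.symm hne)⟩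
  simp only [Finset.sum_add_distrib, ← Finset.mul_sum, Finset.sum_const, Finset.card_range,
    smul_eq_mul, mul_one] at hlt
  have := two_mul_sum_card_filter_add_le hR n
  omega

lemma IsSourcePath.mem_of_forall_not (hf : IsSourcePath E m f)
    (h : ∀ g, ¬ IsSourcePath (_root_.flip E) (m + 1) g) {w : V} (hw : E (f 0) w) :
    ∃ i ≤ m, f i = w := by
  by_contra! hcon
  exact h _ (hf.cons hw hcon)

open Classical in
lemma IsSourcePath.ncard_add_one_le [Finite V] (hE : IsOriented E)
    (hn : 1 ≤ n) (h : ∀ w, E (f 0) w → ∃ i < 2 * n, f i = w) :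
    {w | E (f 0) w}.ncard + 1 ≤
      ((Finset.range n).filter fun i => E (f 0) (f (2 * i + 1))).card + n := by
  have h1 := ncard_le_card_filter_even_add_odd h
  have h2 := card_filter_range_add_one_le (Q := fun i => E (f 0) (f (2 * i))) (n := n) (i := 0)
    hn (fun h => hE _ _ h h)
  omega

/-- The vertices of a non-extendable path of odd length can be arranged in a cycle. -/
lemma IsSourcePath.exists_cycle_of_odd [Fintype V] (hE : SemidegreeBound E k) (hn : 1 ≤ n)
    (hk : 2 * n ≤ k) (hf : IsSourcePath E (2 * n - 1) f)
    (h1 : ∀ g, ¬ IsSourcePath E (2 * n) g) (h2 : ∀ g, ¬ IsSourcePath (_root_.flip E) (2 * n) g) :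
    ∃ c, IsSourceCycle E n c := by
  classical
  have hlen : 2 * n - 1 + 1 = 2 * n := by omega
  have hX := IsSourcePath.ncard_add_one_le (f := f) hE.1 hn fun w hw => by
    obtain ⟨i, hi, hiw⟩ := hf.mem_of_forall_not (by rwa [hlen]) hw
    exact ⟨i, by omega, hiw⟩
  have hfr := hf.reverse (by omega)
  have hY := ncard_le_card_filter_even_add_odd (Q := fun w => E w (f (2 * n - 1))) (n := n)
    (c := f) fun w hw => by
      obtain ⟨i, hi, hiw⟩ := hfr.mem_of_forall_not (w := w) (by rw [hlen]; exact h1) hw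
      exact ⟨2 * n - 1 - i, by omega, hiw⟩
  have hY' := card_filter_range_add_one_le (Q := fun i => E (f (2 * i + 1)) (f (2 * n - 1)))
    (n := n) (i := n - 1) (by omega) (fun h => by
      rw [show 2 * (n - 1) + 1 = 2 * n - 1 by omega] at h
      exact hE.1 _ _ h h)
  have d1 := hE.2.2.1 (f 0)
  have d2 := hE.2.2.2 (f (2 * n - 1))
  obtain ⟨i, hi, hi1, hi2⟩ := exists_of_lt_card_filter_add (n := n)
    (Q := fun i => E (f 0) (f (2 * i + 1))) (R := fun i => E (f (2 * i)) (f (2 * n - 1)))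
    (by omega)
  have key : ∀ a b, a % 2 = 0 → b % 2 = 1 → a < 2 * n → b < 2 * n →
      ((a + 1 = b ∨ b + 1 = a) ∨ (a = 0 ∧ b = 2 * i + 1) ∨ (a = 2 * i ∧ b = 2 * n - 1)) →
      E (f a) (f b) := by
    rintro a b ha hb hab hbn (h | ⟨rfl, rfl⟩ | ⟨rfl, rfl⟩)
    · exact hf.2 _ _ ha hb (by omega) (by omega) h
    · exact hi1
    · exact hi2
  refine ⟨fun a => f (if a ≤ 2 * i then a else 2 * n + 2 * i - a), fun a b ha hb hab => ?_,
    fun a b ha hb ham hbm hab => ?_⟩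
  · have := hf.1 _ _ (by split_ifs <;> omega) (by split_ifs <;> omega) hab
    split_ifs at this <;> omega
  · dsimp only
    apply key <;> split_ifs <;> omega

/-- All but one vertex of a non-extendable path of even length can be arranged in a cycle. -/
lemma IsSourcePath.exists_cycle_of_even [Fintype V] (hE : SemidegreeBound E k) (hn : 1 ≤ n)
    (hk : 2 * n + 1 ≤ k) (hf : IsSourcePath E (2 * n) f)
    (h2 : ∀ g, ¬ IsSourcePath (_root_.flip E) (2 * n + 1) g) :
    ∃ c, IsSourceCycle E n c := by
  classical
  wlog hends : ¬ E (f 0) (f (2 * n)) generalizing f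
  · refine this (hf.reverse_even (by omega)) ?_
    have : 2 * n - 2 * n = 0 := by omega
    simp only [this, Nat.sub_zero]
    exact hE.1 _ _ (not_not.1 hends)
  have hX := IsSourcePath.ncard_add_one_le (f := f) hE.1 hn fun w hw => by
    obtain ⟨i, hi, rfl⟩ := hf.mem_of_forall_not h2 hw
    exact ⟨i, lt_of_le_of_ne hi (by rintro rfl; exact hends hw), rfl⟩
  have hY := ncard_le_card_filter_add (Q := E (f (2 * n))) (a := n) (b := n + 1)
    (p := fun i => if i = 0 then f (2 * n) else f (2 * i - 1))
    (q := fun i => if i = n then f (2 * n - 1) else f (2 * i)) fun w hw => by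
      obtain ⟨i, hi, rfl⟩ := (hf.reverse_even (by omega)).mem_of_forall_not (w := w) h2 hw
      generalize hj : 2 * n - i = j
      rcases exists_of_lt_two_mul (i := j) (n := n + 1) (by omega) with
        ⟨l, hl, rfl⟩ | ⟨l, hl, rfl⟩
      · by_cases hln : l = n
        · exact Or.inl ⟨0, by omega, by simp [hln]⟩
        · exact Or.inr ⟨l, hl, by simp [hln]⟩
      · by_cases hln : l + 1 = n
        · exact Or.inr ⟨n, by omega, by simp [← hln, Nat.mul_add]⟩
        · exact Or.inl ⟨l + 1, by omega, by simp [Nat.mul_add]⟩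
  have hY' := card_filter_range_le
    (fun i => E (f (2 * n)) (if i = n then f (2 * n - 1) else f (2 * i))) (n + 1)
  have d1 := hE.2.2.1 (f 0)
  have d2 := hE.2.2.1 (f (2 * n))
  obtain ⟨i, hi, hi1, hi2⟩ := exists_of_lt_card_filter_add (n := n)
    (Q := fun i => E (f 0) (f (2 * i + 1)))
    (R := fun i => E (f (2 * n)) (if i = 0 then f (2 * n) else f (2 * i - 1))) (by omega)
  have hi0 : i ≠ 0 := by
    rintro rfl
    exact hE.1 _ _ hi2 hi2
  rw [if_neg hi0] at hi2
  have key : ∀ a b, a % 2 = 0 → b % 2 = 1 → a ≤ 2 * n → b ≤ 2 * n →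
      ((a + 1 = b ∨ b + 1 = a) ∨ (a = 0 ∧ b = 2 * i + 1) ∨ (a = 2 * n ∧ b = 2 * i - 1)) →
      E (f a) (f b) := by
    rintro a b ha hb hab hbn (h | ⟨rfl, rfl⟩ | ⟨rfl, rfl⟩)
    · exact hf.2 _ _ ha hb (by omega) (by omega) h
    · exact hi1
    · exact hi2
  refine ⟨fun a => f (if a < 2 * i then a else 2 * n + 2 * i - a), fun a b ha hb hab => ?_,
    fun a b ha hb ham hbm hab => ?_⟩
  · have := hf.1 _ _ (by split_ifs <;> omega) (by split_ifs <;> omega) hab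
    split_ifs at this <;> omega
  · dsimp only
    apply key <;> split_ifs <;> omega

open Classical in
lemma IsSourceCycle.exists_out_edge [Finite V] (hE : IsOriented E) (hn : 1 ≤ n)
    (hd : ∀ v, 3 * n ≤ 2 * {w | E v w}.ncard) :
    ∃ i < n, ∃ w, E (c (2 * i)) w ∧ ∀ j < 2 * n, c j ≠ w := by
  by_contra! hcon
  have hR : ∀ i j, E (c (2 * i)) (c (2 * j)) → ¬ E (c (2 * j)) (c (2 * i)) :=
    fun i j => hE _ _
  have hdeg : ∀ i < n, n ≤ 2 *
      ((Finset.range n).filter fun j => E (c (2 * i)) (c (2 * j))).card := by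
    intro i hi
    have h1 := ncard_le_card_filter_even_add_odd (Q := E (c (2 * i))) (hcon i hi)
    have h2 := card_filter_range_le (fun j => E (c (2 * i)) (c (2 * j + 1))) n
    have := hd (c (2 * i))
    omega
  have h0 := two_mul_card_filter_add_one_eq hR (n := n)
    (fun i hi => (hdeg i hi).trans (by omega)) (i := 0) hn
  have := hdeg 0 hn
  omega

/-- If the oriented graph is dense enough, then a cycle of length `2n` gives a path of length
`2n+1`. -/
lemma IsSourceCycle.exists_path [Fintype V] (hE : SemidegreeBound E k) (hn : 1 ≤ n)
    (hk : 2 * n + 1 ≤ k) (hc : IsSourceCycle E n c) :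
    ∃ g, IsSourcePath (_root_.flip E) (2 * n + 1) g := by
  classical
  by_contra! hno
  have hno' : ∀ g, ¬ IsSourcePath E (2 * n + 1) g := fun g hg => hno _ (hg.reverse (by omega))
  have hw : ∀ i < n, ∀ w, E (c (2 * i)) w → (∀ j < 2 * n, c j ≠ w) →
      ∀ u, E u w → ∃ j < 2 * n, c j = u := by
    intro i hi w hiw hwc u huw
    obtain ⟨g, hg, rfl, hgc⟩ := hc.exists_path_cons hi hiw hwc
    obtain ⟨j, hj, rfl⟩ := hg.mem_of_forall_not hno' huw
    rcases Nat.eq_zero_or_pos j with rfl | hj0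
    · exact absurd huw (fun h => hE.1 _ _ h h)
    · obtain ⟨l, hl, h⟩ := hgc j hj0 hj
      exact ⟨l, hl, h.symm⟩
  have hu : ∀ i < n, ∀ u, E u (c (2 * i + 1)) → (∀ j < 2 * n, c j ≠ u) →
      ∀ w, E u w → ∃ j < 2 * n, c j = w := by
    intro i hi u hiu huc w huw
    obtain ⟨g, hg, rfl, hgc⟩ := hc.reverse.exists_path_cons (r := n - 1 - i) (by omega) (w := u)
      (by rwa [show 2 * n - 1 - 2 * (n - 1 - i) = 2 * i + 1 by omega])
      (fun j hj => huc _ (by omega))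
    obtain ⟨j, hj, rfl⟩ := hg.mem_of_forall_not hno huw
    rcases Nat.eq_zero_or_pos j with rfl | hj0
    · exact absurd huw (fun h => hE.1 _ _ h h)
    · obtain ⟨l, hl, h⟩ := hgc j hj0 hj
      exact ⟨_, by omega, h.symm⟩
  obtain ⟨i, hi, w, hiw, hwc⟩ := IsSourceCycle.exists_out_edge (c := c) hE.1 hn fun v => by
    have := hE.2.2.1 v
    omega
  obtain ⟨i', hi', u, hiu, huc⟩ := IsSourceCycle.exists_out_edge (E := _root_.flip E)
    (c := fun i => c (2 * n - 1 - i)) hE.flip.1 hn fun v => by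
    have := hE.flip.2.2.1 v
    omega
  replace hiu : E u (c (2 * (n - 1 - i') + 1)) := by
    rw [show 2 * (n - 1 - i') + 1 = 2 * n - 1 - 2 * i' by omega]
    exact hiu
  replace huc : ∀ j < 2 * n, c j ≠ u := fun j hj h => huc (2 * n - 1 - j) (by omega) (by
    rwa [show 2 * n - 1 - (2 * n - 1 - j) = j by omega])
  have dw := ncard_le_card_filter_even_add_odd (Q := fun v => E v w) (hw i hi w hiw hwc)
  have du := ncard_le_card_filter_even_add_odd (Q := E u) (hu _ (by omega) u hiu huc)
  have hdw := hE.2.2.2 w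
  have hdu := hE.2.2.1 u
  by_cases huw : u = w
  · subst huw
    have hlt : n < ((Finset.range n).filter fun i => E (c (2 * i)) u).card +
        ((Finset.range n).filter fun i => E u (c (2 * i))).card ∨
        n < ((Finset.range n).filter fun i => E (c (2 * i + 1)) u).card +
        ((Finset.range n).filter fun i => E u (c (2 * i + 1))).card := by
      omega
    rcases hlt with hlt | hlt <;> obtain ⟨j, -, hj, hj'⟩ := exists_of_lt_card_filter_add hlt <;>
      exact hE.1 _ _ hj hj'
  · have dw' := card_filter_range_le (fun j => E (c (2 * j + 1)) w) n
    have du' := card_filter_range_le (fun j => E u (c (2 * j))) n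
    obtain ⟨r, hr, hrw, hru⟩ := exists_of_lt_card_filter_add (n := n)
      (Q := fun j => E (c (2 * j)) w) (R := fun j => E u (c (2 * j + 1))) (by omega)
    obtain ⟨c', hc', h0, h1, -, -, -, himg⟩ := hc.rotate hr
    rw [← h0] at hrw
    rw [← h1] at hru
    have hcw : ∀ j < 2 * n, c' j ≠ w := fun j hj h => by
      obtain ⟨l, hl, hjl⟩ := himg j hj
      exact hwc l hl (hjl ▸ h)
    have hcu : ∀ j < 2 * n, c' j ≠ u := fun j hj h => by
      obtain ⟨l, hl, hjl⟩ := himg j hj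
      exact huc l hl (hjl ▸ h)
    have hpath : IsSourcePath E (2 * n - 1) (fun a => if a = 0 then c' 0 else c' (2 * n - a)) := by
      refine ⟨fun a b ha hb hab => ?_, fun a b ha hb ham hbm hab => ?_⟩
      · dsimp only at hab
        split_ifs at hab <;> have := hc'.1 _ _ (by omega) (by omega) hab <;> omega
      · dsimp only
        rw [if_neg (show b ≠ 0 by omega)]
        split_ifs <;> exact hc'.2 _ _ (by omega) (by omega) (by omega) (by omega) (by omega)
    have hpath' := hpath.reverse (by omega)
    have hpath2 := hpath'.cons (w := u)
      (by
        split_ifs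
        · omega
        · rwa [show 2 * n - (2 * n - 1 - 0) = 1 by omega])
      (fun a ha => by
        split_ifs
        · exact hcu _ (by omega)
        · exact hcu _ (by omega))
    rw [show 2 * n - 1 + 1 = 2 * n by omega] at hpath2
    have hpath3 := (hpath2.reverse_even (by omega)).cons (w := w)
      (by
        rw [if_neg (by omega), if_pos (by omega)]
        exact hrw)
      (fun a ha => by
        split_ifs
        · exact huw
        · exact hcw _ (by omega)
        · exact hcw _ (by omega))
    exact hno _ hpath3

/-- A cycle of length `2n ≤ k` gives a path of length `2n`. -/
lemma IsSourceCycle.exists_path_of_le [Fintype V] (hE : SemidegreeBound E k) (hn : 1 ≤ n)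
    (hk : 2 * n ≤ k) (hc : IsSourceCycle E n c)
    (h1 : ∀ g, ¬ IsSourcePath E (2 * n) g) (h2 : ∀ g, ¬ IsSourcePath (_root_.flip E) (2 * n) g) :
    False := by
  classical
  have hk3 := hE.2.1
  have hw : ∀ i < n, ∀ w, E (c (2 * i)) w → ∃ j < 2 * n, c j = w := by
    intro i hi w hiw
    by_contra! hwc
    obtain ⟨g, hg, -⟩ := hc.exists_path_cons hi hiw hwc
    exact h2 g hg
  have hu : ∀ i < n, ∀ u, E u (c (2 * i + 1)) → ∃ j < 2 * n, c j = u := by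
    intro i hi u hiu
    by_contra! huc
    obtain ⟨g, hg, -⟩ := hc.reverse.exists_path_cons (r := n - 1 - i) (by omega) (w := u)
      (by rwa [show 2 * n - 1 - 2 * (n - 1 - i) = 2 * i + 1 by omega])
      (fun j hj => huc _ (by omega))
    exact h1 g hg
  have hR : ∀ i j, E (c (2 * i)) (c (2 * j)) → ¬ E (c (2 * j)) (c (2 * i)) :=
    fun i j => hE.1 _ _
  have hdeg : ∀ i < n, {w | E (c (2 * i)) w}.ncard ≤ _ := fun i hi =>
    ncard_le_card_filter_even_add_odd (Q := E (c (2 * i))) (hw i hi)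
  have hregular : ∀ i < n, 2 *
      ((Finset.range n).filter fun j => E (c (2 * i)) (c (2 * j))).card + 1 = n := by
    intro i hi
    refine two_mul_card_filter_add_one_eq hR (fun j hj => ?_) hi
    have h1 := hdeg j hj
    have h2 := card_filter_range_le (fun l => E (c (2 * j)) (c (2 * l + 1))) n
    have := hE.2.2.1 (c (2 * j))
    omega
  have hcomplete : ∀ i < n, ∀ j < n, E (c (2 * i)) (c (2 * j + 1)) := by
    intro i hi j hj
    by_contra hij
    have h1 := hdeg i hi
    have h2 := card_filter_range_add_one_le (Q := fun l => E (c (2 * i)) (c (2 * l + 1))) hj hij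
    have := hregular i hi
    have := hE.2.2.1 (c (2 * i))
    omega
  obtain ⟨t, ht, s, hs, hst⟩ : ∃ t < n, ∃ s < n, E (c (2 * s)) (c (2 * t)) := by
    have h0 := hregular 0 hn
    have hpos : 0 < ((Finset.range n).filter fun j => E (c (2 * 0)) (c (2 * j))).card := by
      have h1 := hdeg 0 hn
      have h2 := card_filter_range_le (fun l => E (c (2 * 0)) (c (2 * l + 1))) n
      have := hE.2.2.1 (c (2 * 0))
      omega
    obtain ⟨t, ht⟩ := Finset.card_pos.1 hpos
    rw [Finset.mem_filter, Finset.mem_range] at ht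
    exact ⟨t, ht.1, 0, hn, ht.2⟩
  obtain ⟨x, hxt, hxc⟩ : ∃ x, E x (c (2 * t)) ∧ ∀ j < 2 * n, c j ≠ x := by
    by_contra! hcon
    have h1 := ncard_le_card_filter_even_add_odd (Q := fun v => E v (c (2 * t))) hcon
    have h2 := card_filter_range_le (fun l => E (c (2 * l)) (c (2 * t))) n
    have h3 : ((Finset.range n).filter fun l => E (c (2 * l + 1)) (c (2 * t))).card = 0 := by
      rw [Finset.card_eq_zero, Finset.filter_eq_empty_iff]
      exact fun l hl h => hE.1 _ _ h (hcomplete t ht l (Finset.mem_range.1 hl))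
    have := hE.2.2.2 (c (2 * t))
    omega
  obtain ⟨w, hxw, hwc⟩ : ∃ w, E x w ∧ ∀ j < 2 * n, c j ≠ w := by
    by_contra! hcon
    have h1 := ncard_le_card_filter_even_add_odd (Q := E x) hcon
    have h2 := card_filter_range_le (fun l => E x (c (2 * l))) n
    have h3 : ((Finset.range n).filter fun l => E x (c (2 * l + 1))).card = 0 := by
      rw [Finset.card_eq_zero, Finset.filter_eq_empty_iff]
      intro l hl h
      obtain ⟨j, hj, hjx⟩ := hu l (Finset.mem_range.1 hl) x h
      exact hxc j hj hjx
    have := hE.2.2.1 x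
    omega
  obtain ⟨c', hc', h0, -, hev, hodd, hsurj, himg⟩ := hc.rotate ht
  obtain ⟨j, hj, hjs⟩ := hsurj s hs
  rw [← h0] at hxt
  rw [← hjs, ← h0] at hst
  have hj0 : j ≠ 0 := by
    rintro rfl
    exact hE.1 _ _ hst hst
  have hxc' : ∀ j < 2 * n, c' j ≠ x := fun j hj h => by
    obtain ⟨l, hl, hjl⟩ := himg j hj
    exact hxc l hl (hjl ▸ h)
  have hwc' : ∀ j < 2 * n, c' j ≠ w := fun j hj h => by
    obtain ⟨l, hl, hjl⟩ := himg j hj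
    exact hwc l hl (hjl ▸ h)
  have hjoin : E (c' 2) (c' (2 * n - 1)) := by
    obtain ⟨p, hp, hp'⟩ := hev 1 (by omega)
    obtain ⟨q, hq, hq'⟩ := hodd (n - 1) (by omega)
    rw [show 2 * (n - 1) + 1 = 2 * n - 1 by omega] at hq'
    rw [mul_one] at hp'
    rw [hp', hq']
    exact hcomplete p hp q hq
  have key : ∀ a b, a % 2 = 0 → b % 2 = 1 → a < 2 * n → b < 2 * n →
      ((a + 1 = b ∨ b + 1 = a) ∨ (a = 2 ∧ b = 2 * n - 1)) → E (c' a) (c' b) := by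
    rintro a b ha hb hab hbn (h | ⟨rfl, rfl⟩)
    · exact hc'.2 _ _ ha hb hab hbn (by omega)
    · exact hjoin
  have hpath : IsSourcePath E (2 * n - 3)
      (fun a => c' (if a < 2 * n - 2 * j then 2 * j + a else a + 2 * j + 2 - 2 * n)) := by
    refine ⟨fun a b ha hb hab => ?_, fun a b ha hb ham hbm hab => ?_⟩
    · have := hc'.1 _ _ (by split_ifs <;> omega) (by split_ifs <;> omega) hab
      split_ifs at this <;> omega
    · dsimp only
      apply key <;> split_ifs <;> omega
  have hpath1 := hpath.cons (w := c' 0) (by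
      rwa [if_pos (by omega)]) (fun a ha h => by
      have := hc'.1 _ _ (by split_ifs <;> omega) (by omega) h
      split_ifs at this <;> omega)
  have hpath2 := hpath1.cons (w := x) hxt (fun a ha => by
      split_ifs <;> exact hxc' _ (by omega))
  have hpath3 := hpath2.cons (w := w) hxw (fun a ha => by
      split_ifs
      · rintro rfl
        exact hE.1 _ _ hxw hxw
      all_goals exact hwc' _ (by omega))
  rw [show 2 * n - 3 + 1 + 1 + 1 = 2 * n by omega] at hpath3
  exact h2 _ hpath3

/-- A path of length `m < k` gives a path of length `m + 1`. -/
lemma IsSourcePath.exists_succ [Fintype V] (hE : SemidegreeBound E k) (hm : 1 ≤ m) (hk : m < k)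
    (hf : IsSourcePath E m f) :
    (∃ g, IsSourcePath E (m + 1) g) ∨ ∃ g, IsSourcePath (_root_.flip E) (m + 1) g := by
  by_contra! hno
  obtain ⟨h1, h2⟩ := hno
  rcases Nat.even_or_odd' m with ⟨n, rfl | rfl⟩
  · obtain ⟨c, hc⟩ := hf.exists_cycle_of_even hE (by omega) (by omega) h2
    obtain ⟨g, hg⟩ := hc.exists_path hE (by omega) (by omega)
    exact h2 g hg
  · obtain ⟨c, hc⟩ := IsSourcePath.exists_cycle_of_odd (n := n + 1) hE (by omega) (by omega)
      hf h1 h2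
    exact hc.exists_path_of_le hE (by omega) (by omega) h1 h2

set_option maxHeartbeats 1000000 in
/-- If `k` is even, then a path of length `k` between sources gives one between sinks. -/
lemma IsSourcePath.exists_flip [Fintype V] (hE : SemidegreeBound E (2 * n))
    (hf : IsSourcePath E (2 * n) f) : ∃ g, IsSourcePath (_root_.flip E) (2 * n) g := by
  classical
  by_contra! hno
  have hk3 := hE.2.1
  have hlen : 2 * n - 1 + 1 = 2 * n := by omega
  have hends : ∀ {f : ℕ → V}, IsSourcePath E (2 * n) f → ∀ w, E (f 0) w →
      ∃ i, 1 ≤ i ∧ i < 2 * n ∧ f i = w := by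
    intro f hf w hw
    obtain ⟨i, hi, rfl⟩ :=
      (hf.mono (m := 2 * n - 1) (by omega)).mem_of_forall_not (by rwa [hlen]) hw
    refine ⟨i, Nat.one_le_iff_ne_zero.2 ?_, by omega, rfl⟩
    rintro rfl
    exact hE.1 _ _ hw hw
  have hfr := hf.reverse_even (by omega)
  have hX := ncard_le_card_filter_even_add_odd (Q := E (f 0)) (c := f) (n := n) fun w hw => by
    obtain ⟨i, -, hi, h⟩ := hends hf w hw
    exact ⟨i, hi, h⟩
  have hmem : ∀ w, E (f (2 * n)) w → ∃ i, 1 ≤ i ∧ i < 2 * n ∧ f i = w := fun w hw => by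
    obtain ⟨i, hi1, hi, h⟩ := hends hfr w hw
    exact ⟨2 * n - i, by omega, by omega, h⟩
  have hY := ncard_le_card_filter_even_add_odd (Q := E (f (2 * n))) (c := f) (n := n)
    fun w hw => by
      obtain ⟨i, -, hi, h⟩ := hmem w hw
      exact ⟨i, hi, h⟩
  have h00 : ¬ E (f 0) (f 0) := fun h => hE.1 _ _ h h
  have hn0 : ¬ E (f (2 * n)) (f 0) := fun h => by
    obtain ⟨i, hi1, hi, h⟩ := hmem _ h
    have := hf.1 _ _ (by omega) (by omega) h
    omega
  have hcommon : ∀ j < n, E (f 0) (f (2 * j)) → ¬ E (f (2 * n)) (f (2 * j)) := by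
    intro j hj h1 h2
    have hj0 : j ≠ 0 := by
      rintro rfl
      exact h00 h1
    refine hno (fun a => f (if a < 2 * j then 2 * j - 1 - a else if a = 2 * j then 2 * j else
      2 * n + 2 * j + 1 - a)) ⟨fun a b ha hb hab => ?_, fun a b ha hb ham hbm hab => ?_⟩
    · have := hf.1 _ _ (by split_ifs <;> omega) (by split_ifs <;> omega) hab
      split_ifs at this <;> omega
    · have key : ∀ a b, a ≤ 2 * n → b ≤ 2 * n → ((a % 2 = 0 ∧ b % 2 = 1 ∧
          (a + 1 = b ∨ b + 1 = a)) ∨ (a = 0 ∧ b = 2 * j) ∨ (a = 2 * n ∧ b = 2 * j)) →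
          E (f a) (f b) := by
        rintro a b ha hb (⟨ha', hb', h⟩ | ⟨rfl, rfl⟩ | ⟨rfl, rfl⟩)
        · exact hf.2 _ _ ha' hb' ha hb h
        · exact h1
        · exact h2
      dsimp only [_root_.flip]
      apply key <;> split_ifs <;> omega
  have hb : ((Finset.range n).filter fun j => E (f 0) (f (2 * j))).card +
      ((Finset.range n).filter fun j => E (f (2 * n)) (f (2 * j))).card + 1 ≤ n := by
    rw [← Finset.card_union_of_disjoint
      (Finset.disjoint_filter.2 fun j hj => hcommon j (Finset.mem_range.1 hj)),
      ← Finset.filter_or]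
    exact card_filter_range_add_one_le (i := 0) (by omega) (by rintro (h | h); exacts [h00 h, hn0 h])
  have d1 := hE.2.2.1 (f 0)
  have d2 := hE.2.2.1 (f (2 * n))
  have ha := card_filter_range_le (fun j => E (f 0) (f (2 * j + 1))) n
  have ha' := card_filter_range_le (fun j => E (f (2 * n)) (f (2 * j + 1))) n
  have hfull : ∀ j < n, E (f 0) (f (2 * j + 1)) := fun j hj => by
    by_contra h
    have := card_filter_range_add_one_le (Q := fun j => E (f 0) (f (2 * j + 1))) hj h
    omega
  have hfull' : ∀ j < n, E (f (2 * n)) (f (2 * j + 1)) := fun j hj => by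
    by_contra h
    have := card_filter_range_add_one_le (Q := fun j => E (f (2 * n)) (f (2 * j + 1))) hj h
    omega
  obtain ⟨j, hj⟩ := Finset.card_pos.1
    (show 0 < ((Finset.range n).filter fun j => E (f (2 * n)) (f (2 * j))).card by omega)
  rw [Finset.mem_filter, Finset.mem_range] at hj
  have hj0 : j ≠ 0 := by
    rintro rfl
    exact hn0 hj.2
  have key : ∀ a b, a ≤ 2 * n → b ≤ 2 * n → ((a % 2 = 0 ∧ b % 2 = 1 ∧
      (a + 1 = b ∨ b + 1 = a)) ∨ (a = 0 ∧ b = 2 * n - 1) ∨ (a = 2 * n ∧ b = 2 * j - 1) ∨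
      (a = 2 * n ∧ b = 2 * j)) → E (f a) (f b) := by
    rintro a b ha hb (⟨ha', hb', h⟩ | ⟨rfl, rfl⟩ | ⟨rfl, rfl⟩ | ⟨rfl, rfl⟩)
    · exact hf.2 _ _ ha' hb' ha hb h
    · have := hfull (n - 1) (by omega)
      rwa [show 2 * (n - 1) + 1 = 2 * n - 1 by omega] at this
    · have := hfull' (j - 1) (by omega)
      rwa [show 2 * (j - 1) + 1 = 2 * j - 1 by omega] at this
    · exact hj.2
  refine hno (fun a => f (if a < 2 * n - 2 * j - 1 then 2 * j + 1 + a else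
    if a < 2 * n - 1 then a - (2 * n - 2 * j - 1) else if a = 2 * n - 1 then 2 * n else 2 * j))
    ⟨fun a b ha hb hab => ?_, fun a b ha hb ham hbm hab => ?_⟩
  · have := hf.1 _ _ (by split_ifs <;> omega) (by split_ifs <;> omega) hab
    split_ifs at this <;> omega
  · dsimp only [_root_.flip]
    apply key <;> split_ifs <;> omega

lemma SemidegreeBound.exists_edge [Fintype V] (hE : SemidegreeBound E k) (v : V) :
    ∃ w, E v w := by
  have h := hE.2.2.1 v
  have hk := hE.2.1
  have hne : {w | E v w}.ncard ≠ 0 := by omega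
  exact Set.nonempty_of_ncard_ne_zero hne

lemma SemidegreeBound.exists_path [Fintype V] [Nonempty V] (hE : SemidegreeBound E k)
    (hm : 1 ≤ m) (hk : m ≤ k) :
    (∃ g, IsSourcePath E m g) ∨ ∃ g, IsSourcePath (_root_.flip E) m g := by
  induction m, hm using Nat.le_induction with
  | base =>
    obtain ⟨v⟩ := ‹Nonempty V›
    obtain ⟨w, hw⟩ := hE.exists_edge v
    have hpath : IsSourcePath E 0 fun _ => v :=
      ⟨fun i j hi hj _ => by omega, fun a b ha hb ham hbm hab => by omega⟩
    refine Or.inr ⟨_, hpath.cons hw ?_⟩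
    rintro - - rfl
    exact hE.1 _ _ hw hw
  | succ m hm ih =>
    rcases ih (by omega) with ⟨g, hg⟩ | ⟨g, hg⟩
    · exact hg.exists_succ hE hm hk
    · exact (hg.exists_succ hE.flip hm hk).symm

lemma SemidegreeBound.exists_sourcePath [Fintype V] [Nonempty V] (hE : SemidegreeBound E k) :
    ∃ g, IsSourcePath E k g := by
  have hk3 := hE.2.1
  rcases hE.exists_path (m := k) (by omega) le_rfl with h | ⟨g, hg⟩
  · exact h
  · rcases Nat.even_or_odd' k with ⟨n, rfl | rfl⟩
    · exact hg.exists_flip hE.flip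
    · exact ⟨_, hg.reverse (by omega)⟩

lemma IsSourcePath.isAntipath (hf : IsSourcePath E m f) :
    IsAntipath E m f (fun i => decide (i % 2 = 0)) := by
  refine ⟨fun i hi j hj hij => hf.1 _ _ hi hj hij, fun i hi => ?_, fun i hi => ?_⟩
  · by_cases h : i % 2 = 0
    · simpa [h, _root_.flip] using hf.2 i (i + 1) h (by omega) (by omega) (by omega) (by omega)
    · simpa [h] using hf.2 (i + 1) i (by omega) (by omega) (by omega) (by omega) (by omega)
  · by_cases h : i % 2 = 0 <;> simp [h] <;> omega

lemma IsSourcePath.isAntipath_of_flip (hf : IsSourcePath (_root_.flip E) m f) :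
    IsAntipath E m f (fun i => decide (i % 2 = 1)) := by
  refine ⟨fun i hi j hj hij => hf.1 _ _ hi hj hij, fun i hi => ?_, fun i hi => ?_⟩
  · by_cases h : i % 2 = 0
    · simpa [h, _root_.flip] using hf.2 i (i + 1) h (by omega) (by omega) (by omega) (by omega)
    · have h' : i % 2 = 1 := by omega
      simpa [h', _root_.flip] using hf.2 (i + 1) i (by omega) (by omega) (by omega) (by omega) (by omega)
  · by_cases h : i % 2 = 1 <;> simp [h] <;> omega

end

/-- For `k ≥ 3`, every oriented graph of minimum semidegree at least `(3k-2)/4`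
contains every antidirected path of length `k`. -/
theorem stmt_8 {V : Type*} [Fintype V] [Nonempty V] (D : V → V → Prop)
    (hor : IsOriented D) (k : ℕ) (hk : 3 ≤ k)
    (hdeg : ∀ v, (3 * (k : ℝ) - 2) / 4 ≤ (outDeg D v : ℝ) ∧
      (3 * (k : ℝ) - 2) / 4 ≤ (inDeg D v : ℝ)) :
    ContainsAllAntipaths D k := by
  have hE : SemidegreeBound D k := by
    refine ⟨hor, hk, fun v => ?_, fun v => ?_⟩
    · have h : 3 * (k : ℝ) ≤ 4 * (outDeg D v : ℝ) + 2 := by linarith [(hdeg v).1]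
      exact_mod_cast h
    · have h : 3 * (k : ℝ) ≤ 4 * (inDeg D v : ℝ) + 2 := by linarith [(hdeg v).2]
      exact_mod_cast h
  rintro (_ | _)
  · obtain ⟨f, hf⟩ := hE.flip.exists_sourcePath
    exact ⟨f, _, hf.isAntipath_of_flip, rfl⟩
  · obtain ⟨f, hf⟩ := hE.exists_sourcePath
    exact ⟨f, _, hf.isAntipath, rfl⟩
end

section
/- For every positive natural number k, every oriented graph D with more than (3k-4)·|V(D)|/2 edges contains every antidirected path of length k. -/
/-- `x 0, y 0, x 1, y 1, …` is an antidirected path of `D` with `n` vertices `x i` of in-degree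
`0` and `m` vertices `y i` of out-degree `0`. -/
structure AltPath {V : Type*} (D : V → V → Prop) (n m : ℕ) (x y : ℕ → V) : Prop where
  x_inj : ∀ i < n, ∀ j < n, x i = x j → i = j
  y_inj : ∀ i < m, ∀ j < m, y i = y j → i = j
  x_ne_y : ∀ i < n, ∀ j < m, x i ≠ y j
  edge : ∀ i < n, i < m → D (x i) (y i)
  edge_succ : ∀ i, i + 1 < n → i < m → D (x (i + 1)) (y i)

/-- `D` has an alternating path with `n` sources and `m` sinks that starts at a source. -/
def HasAltPath {V : Type*} (D : V → V → Prop) (n m : ℕ) : Prop :=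
  ∃ x y, AltPath D n m x y

/-- `x 0, y 0, …, x (a - 1), y (a - 1)` is an antidirected cycle of `D`; the case `a = 1`,
a single edge, is allowed. -/
structure AltCycle {V : Type*} (D : V → V → Prop) (a : ℕ) (x y : ℕ → V) : Prop
    extends AltPath D a a x y where
  edge_close : D (x 0) (y (a - 1))

/-- `w` is one of the vertices `x i` with `i < n` or `y j` with `j < m`. -/
def OnPath {V : Type*} (n m : ℕ) (x y : ℕ → V) (w : V) : Prop :=
  (∃ i < n, w = x i) ∨ ∃ j < m, w = y j

/-- The sequence `w, y 0, y 1, …`. -/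
def consSeq {V : Type*} (w : V) (y : ℕ → V) (i : ℕ) : V := if i = 0 then w else y (i - 1)

section AltPath

variable {V : Type*} {D : V → V → Prop} {n m a : ℕ} {x y : ℕ → V}

theorem AltPath.mono {D' : V → V → Prop} (h : AltPath D n m x y) (hD : ∀ u v, D u v → D' u v) :
    AltPath D' n m x y :=
  ⟨h.x_inj, h.y_inj, h.x_ne_y, fun i hi hj => hD _ _ (h.edge i hi hj),
    fun i hi hj => hD _ _ (h.edge_succ i hi hj)⟩

theorem AltPath.truncate {n' m' : ℕ} (h : AltPath D n m x y) (hn : n' ≤ n) (hm : m' ≤ m) :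
    AltPath D n' m' x y :=
  ⟨fun i hi j hj => h.x_inj i (by omega) j (by omega),
    fun i hi j hj => h.y_inj i (by omega) j (by omega),
    fun i hi j hj => h.x_ne_y i (by omega) j (by omega),
    fun i hi hj => h.edge i (by omega) (by omega),
    fun i hi hj => h.edge_succ i (by omega) (by omega)⟩

theorem AltPath.reverse_balanced (h : AltPath D a a x y) :
    AltPath (flip D) a a (fun i => y (a - 1 - i)) (fun i => x (a - 1 - i)) where
  x_inj i hi j hj e := by have := h.y_inj _ (by omega) _ (by omega) e; omega
  y_inj i hi j hj e := by have := h.x_inj _ (by omega) _ (by omega) e; omega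
  x_ne_y i hi j hj e := h.x_ne_y _ (by omega) _ (by omega) e.symm
  edge i hi hj := h.edge _ (by omega) (by omega)
  edge_succ i hi hj := by
    have := h.edge_succ (a - 1 - (i + 1)) (by omega) (by omega)
    rwa [show a - 1 - (i + 1) + 1 = a - 1 - i by omega] at this

theorem AltPath.reverse_succ (h : AltPath D (a + 1) a x y) :
    AltPath D (a + 1) a (fun i => x (a - i)) (fun i => y (a - 1 - i)) where
  x_inj i hi j hj e := by have := h.x_inj _ (by omega) _ (by omega) e; omega
  y_inj i hi j hj e := by have := h.y_inj _ (by omega) _ (by omega) e; omega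
  x_ne_y i hi j hj e := h.x_ne_y _ (by omega) _ (by omega) e
  edge i hi hj := by
    have := h.edge_succ (a - 1 - i) (by omega) (by omega)
    rwa [show a - 1 - i + 1 = a - i by omega] at this
  edge_succ i hi hj := by
    have := h.edge (a - (i + 1)) (by omega) (by omega)
    rwa [show y (a - (i + 1)) = y (a - 1 - i) by congr 1; omega] at this

theorem AltPath.prepend (h : AltPath D n m x y) {w : V} (hw : ¬ OnPath n m x y w)
    (hD : D (x 0) w) : AltPath (flip D) (m + 1) n (consSeq w y) x where
  x_inj i hi j hj e := by
    have hw' : ∀ l < m, w ≠ y l := fun l hl e => hw (Or.inr ⟨l, hl, e⟩)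
    unfold consSeq at e
    split_ifs at e with h1 h2 h2
    · omega
    · exact absurd e (hw' _ (by omega))
    · exact absurd e.symm (hw' _ (by omega))
    · have := h.y_inj _ (by omega) _ (by omega) e
      omega
  y_inj := h.x_inj
  x_ne_y i hi j hj e := by
    unfold consSeq at e
    split_ifs at e with h1
    · exact hw (Or.inl ⟨j, hj, e⟩)
    · exact h.x_ne_y j hj _ (by omega) e.symm
  edge i hi hj := by
    unfold consSeq flip
    split_ifs with h1
    · rwa [h1]
    · have := h.edge_succ (i - 1) (by omega) (by omega)
      rwa [show i - 1 + 1 = i by omega] at this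
  edge_succ i hi hj := by
    unfold consSeq flip
    simpa using h.edge i hj (by omega)

theorem HasAltPath.flip_balanced (h : HasAltPath D a a) : HasAltPath (flip D) a a := by
  obtain ⟨x, y, h⟩ := h
  exact ⟨_, _, h.reverse_balanced⟩

theorem HasAltPath.flip_succ (h : HasAltPath D (a + 1) (a + 1)) :
    HasAltPath (flip D) (a + 1) a := by
  obtain ⟨x, y, h⟩ := h
  exact ⟨_, _, h.reverse_balanced.truncate le_rfl (by omega)⟩

theorem AltCycle.reverse (h : AltCycle D a x y) :
    AltCycle (flip D) a (fun i => y (a - 1 - i)) (fun i => x (a - 1 - i)) :=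
  ⟨h.toAltPath.reverse_balanced, by
    have := h.edge_close
    unfold flip
    simpa using this⟩

theorem onPath_reverse {w : V} :
    OnPath a a (fun i => y (a - 1 - i)) (fun i => x (a - 1 - i)) w ↔ OnPath a a x y w := by
  constructor
  · rintro (⟨i, hi, e⟩ | ⟨i, hi, e⟩)
    · exact Or.inr ⟨_, by omega, e⟩
    · exact Or.inl ⟨_, by omega, e⟩
  · rintro (⟨i, hi, e⟩ | ⟨i, hi, e⟩)
    · exact Or.inr ⟨a - 1 - i, by omega, by rw [e]; congr 1; omega⟩
    · exact Or.inl ⟨a - 1 - i, by omega, by rw [e]; congr 1; omega⟩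

/-- An alternating cycle can be cut open at the edge `x i → y i`. -/
theorem AltCycle.rotate (h : AltCycle D a x y) {i : ℕ} (hi : i < a) :
    ∃ x' y', AltPath D a a x' y' ∧ x' 0 = x i ∧ y' (a - 1) = y i ∧
      ∀ w, OnPath a a x' y' w → OnPath a a x y w := by
  refine ⟨fun j => if j ≤ i then x (i - j) else x (i + a - j),
    fun j => if j < i then y (i - 1 - j) else y (i + a - 1 - j), ⟨?_, ?_, ?_, ?_, ?_⟩, ?_, ?_, ?_⟩
  · intro j hj l hl e
    split_ifs at e <;> (have := h.x_inj _ (by omega) _ (by omega) e; omega)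
  · intro j hj l hl e
    split_ifs at e <;> (have := h.y_inj _ (by omega) _ (by omega) e; omega)
  · intro j hj l hl e
    split_ifs at e <;> exact h.x_ne_y _ (by omega) _ (by omega) e
  · intro j hj _
    rcases lt_trichotomy j i with hji | hji | hji
    · rw [if_pos hji.le, if_pos hji]
      have := h.edge_succ (i - 1 - j) (by omega) (by omega)
      rwa [show i - 1 - j + 1 = i - j by omega] at this
    · rw [if_pos hji.le, if_neg (by omega), show i - j = 0 by omega,
        show i + a - 1 - j = a - 1 by omega]
      exact h.edge_close
    · rw [if_neg (by omega), if_neg (by omega)]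
      have := h.edge_succ (i + a - 1 - j) (by omega) (by omega)
      rwa [show i + a - 1 - j + 1 = i + a - j by omega] at this
  · intro j hj _
    by_cases hji : j < i
    · rw [if_pos (by omega), if_pos hji, show i - (j + 1) = i - 1 - j by omega]
      exact h.edge _ (by omega) (by omega)
    · rw [if_neg (by omega), if_neg (by omega), show i + a - (j + 1) = i + a - 1 - j by omega]
      exact h.edge _ (by omega) (by omega)
  · simp
  · dsimp only
    rw [if_neg (by omega)]
    congr 1
    omega
  · rintro w (⟨j, hj, e⟩ | ⟨j, hj, e⟩)
    · left
      dsimp only at e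
      split_ifs at e
      · exact ⟨_, by omega, e⟩
      · exact ⟨_, by omega, e⟩
    · right
      dsimp only at e
      split_ifs at e
      · exact ⟨_, by omega, e⟩
      · exact ⟨_, by omega, e⟩

/-- Two crossing chords at the ends of a balanced path close it up to a cycle. -/
theorem AltPath.cycle_of_balanced (h : AltPath D a a x y) {i : ℕ} (hi : i < a)
    (h0 : D (x 0) (y i)) (h1 : D (x i) (y (a - 1))) : ∃ x' y', AltCycle D a x' y' := by
  refine ⟨fun j => if j ≤ i then x j else x (a + i - j),
    fun j => if j < i then y j else y (a - 1 + i - j), ⟨?_, ?_, ?_, ?_, ?_⟩, ?_⟩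
  · intro j hj l hl e
    split_ifs at e <;> (have := h.x_inj _ (by omega) _ (by omega) e; omega)
  · intro j hj l hl e
    split_ifs at e <;> (have := h.y_inj _ (by omega) _ (by omega) e; omega)
  · intro j hj l hl e
    split_ifs at e <;> exact h.x_ne_y _ (by omega) _ (by omega) e
  · intro j hj _
    rcases lt_trichotomy j i with hji | hji | hji
    · rw [if_pos hji.le, if_pos hji]
      exact h.edge _ (by omega) (by omega)
    · subst hji
      rw [if_pos le_rfl, if_neg (by omega), show a - 1 + j - j = a - 1 by omega]
      exact h1
    · rw [if_neg (by omega), if_neg (by omega)]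
      have := h.edge_succ (a - 1 + i - j) (by omega) (by omega)
      rwa [show a - 1 + i - j + 1 = a + i - j by omega] at this
  · intro j hj _
    by_cases hji : j < i
    · rw [if_pos (by omega), if_pos hji]
      exact h.edge_succ _ (by omega) (by omega)
    · rw [if_neg (by omega), if_neg (by omega), show a + i - (j + 1) = a - 1 + i - j by omega]
      exact h.edge _ (by omega) (by omega)
  · rw [if_pos (by omega), if_neg (by omega), show a - 1 + i - (a - 1) = i by omega]
    exact h0

/-- Suitable chords at the ends of a path with source ends give a cycle that misses exactly
one source of the path. -/
theorem AltPath.cycle_of_succ (h : AltPath D (a + 1) a x y) {i : ℕ} (hi0 : 0 < i) (hi : i < a)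
    (h0 : D (x 0) (y i)) (h1 : D (x a) (y (i - 1))) : ∃ x' y', AltCycle D a x' y' := by
  refine ⟨fun j => if j < i then x j else x (a + i - j),
    fun j => if j < i then y j else y (a - 1 + i - j), ⟨?_, ?_, ?_, ?_, ?_⟩, ?_⟩
  · intro j hj l hl e
    split_ifs at e <;> (have := h.x_inj _ (by omega) _ (by omega) e; omega)
  · intro j hj l hl e
    split_ifs at e <;> (have := h.y_inj _ (by omega) _ (by omega) e; omega)
  · intro j hj l hl e
    split_ifs at e <;> exact h.x_ne_y _ (by omega) _ (by omega) e
  · intro j hj _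
    by_cases hji : j < i
    · rw [if_pos hji, if_pos hji]
      exact h.edge _ (by omega) (by omega)
    · rw [if_neg (by omega), if_neg (by omega)]
      have := h.edge_succ (a - 1 + i - j) (by omega) (by omega)
      rwa [show a - 1 + i - j + 1 = a + i - j by omega] at this
  · intro j hj _
    rcases lt_trichotomy (j + 1) i with hji | hji | hji
    · rw [if_pos hji, if_pos (by omega)]
      exact h.edge_succ _ (by omega) (by omega)
    · rw [if_neg (by omega), if_pos (by omega), show a + i - (j + 1) = a by omega,
        show j = i - 1 by omega]
      exact h1
    · rw [if_neg (by omega), if_neg (by omega), show a + i - (j + 1) = a - 1 + i - j by omega]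
      exact h.edge _ (by omega) (by omega)
  · rw [if_pos (by omega), if_neg (by omega), show a - 1 + i - (a - 1) = i by omega]
    exact h0

theorem isOriented_flip (hor : IsOriented D) : IsOriented (flip D) := fun u v h => hor v u h

theorem edgeCount_flip (D : V → V → Prop) : edgeCount (flip D) = edgeCount D := by
  unfold edgeCount
  exact Set.ncard_congr (fun z _ => z.swap) (fun z hz => hz)
    (fun z w _ _ h => Prod.swap_injective h) (fun z hz => ⟨z.swap, hz, by simp⟩)

theorem AltCycle.closed_of_not_hasAltPath (h : AltCycle D a x y)
    (hin : ¬ HasAltPath (flip D) (a + 1) a) {i : ℕ} (hi : i < a) {w : V} (hw : D (x i) w) :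
    OnPath a a x y w := by
  by_contra hc
  obtain ⟨x', y', h', hx', -, hon⟩ := h.rotate hi
  exact hin ⟨_, _, h'.prepend (fun hw' => hc (hon w hw')) (by rwa [hx'])⟩

/-- If no path has more than `2 * a + 1` vertices, all in-neighbours of an out-neighbour of a
source of a `2 * a`-cycle lie on the cycle. -/
theorem AltCycle.inNeighbor_onPath (h : AltCycle D a x y) (hor : IsOriented D)
    (hno : ¬ HasAltPath D (a + 1) (a + 1)) {i : ℕ} (hi : i < a) {v w : V}
    (hv : D (x i) v) (hvC : ¬ OnPath a a x y v) (hw : D w v) : OnPath a a x y w := by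
  by_contra hc
  obtain ⟨x', y', h', hx', -, hon⟩ := h.rotate hi
  refine hno ⟨_, _, (h'.prepend (fun hv' => hvC (hon v hv')) (by rwa [hx'])).prepend
    (w := w) ?_ (by simpa [consSeq, flip] using hw)⟩
  rintro (⟨j, hj, e⟩ | ⟨j, hj, e⟩)
  · unfold consSeq at e
    split_ifs at e
    · subst e
      exact hor _ _ hw hw
    · exact hc (hon w (Or.inr ⟨_, by omega, e⟩))
  · exact hc (hon w (Or.inl ⟨j, hj, e⟩))

/-- Attaching two distinct new vertices at the two ends of a cycle cut open. -/
theorem AltCycle.hasAltPath_of_pendant (h : AltCycle D a x y) {i : ℕ} (hi : i < a) {v z : V}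
    (hv : D (x i) v) (hz : D z (y i)) (hvC : ¬ OnPath a a x y v) (hzC : ¬ OnPath a a x y z)
    (hvz : z ≠ v) : HasAltPath D (a + 1) (a + 1) := by
  obtain ⟨x', y', h', hx', hy', hon⟩ := h.rotate hi
  have hp := (h'.prepend (fun hv' => hvC (hon v hv')) (by rwa [hx'])).reverse_succ
  refine ⟨_, _, hp.prepend (w := z) ?_ ?_⟩
  · rintro (⟨j, hj, e⟩ | ⟨j, hj, e⟩)
    · unfold consSeq at e
      dsimp only at e
      split_ifs at e
      · exact hvz e
      · exact hzC (hon z (Or.inr ⟨_, by omega, e⟩))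
    · exact hzC (hon z (Or.inl ⟨a - 1 - j, by omega, e⟩))
  · unfold consSeq flip
    rw [if_neg (by omega), Nat.sub_zero, hy']
    exact hz

end AltPath

section Counting

open Finset

variable {V : Type*} {D : V → V → Prop} {a s t : ℕ} {x y : ℕ → V}

theorem card_le_of_cover (S : Finset V) (I J : Finset ℕ)
    (h : ∀ w ∈ S, (∃ i ∈ I, w = x i) ∨ ∃ j ∈ J, w = y j) : #S ≤ #I + #J := by
  classical
  have hS : S ⊆ I.image x ∪ J.image y := by
    intro w hw
    rw [mem_union, mem_image, mem_image]
    exact (h w hw).imp (fun ⟨i, hi, e⟩ => ⟨i, hi, e.symm⟩) (fun ⟨i, hi, e⟩ => ⟨i, hi, e.symm⟩)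
  calc #S ≤ #(I.image x ∪ J.image y) := card_le_card hS
    _ ≤ #(I.image x) + #(J.image y) := card_union_le _ _
    _ ≤ #I + #J := Nat.add_le_add card_image_le card_image_le

open Classical in
theorem two_mul_sum_card_add_le (R : ℕ → ℕ → Prop) (hR : ∀ i j, R i j → ¬ R j i) (a : ℕ) :
    2 * ∑ i ∈ range a, #{j ∈ range a | R i j} + a ≤ a * a := by
  have hswap : ∑ i ∈ range a, #{j ∈ range a | R i j} =
      ∑ i ∈ range a, #{j ∈ range a | R j i} :=
    sum_card_bipartiteAbove_eq_sum_card_bipartiteBelow R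
  have hle : ∀ i ∈ range a, #{j ∈ range a | R i j} + #{j ∈ range a | R j i} + 1 ≤ a := by
    intro i hi
    have hdisj : Disjoint {j ∈ range a | R i j} {j ∈ range a | R j i} := by
      rw [disjoint_filter]
      exact fun j _ h => hR i j h
    have hsub : {j ∈ range a | R i j} ∪ {j ∈ range a | R j i} ⊆ (range a).erase i := by
      intro j hj
      rw [mem_union, mem_filter, mem_filter] at hj
      rw [mem_erase]
      refine ⟨?_, hj.elim And.left And.left⟩
      rintro rfl
      exact hj.elim (fun h => hR _ _ h.2 h.2) (fun h => hR _ _ h.2 h.2)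
    have hcard := card_le_card hsub
    rw [card_union_of_disjoint hdisj, card_erase_of_mem hi, card_range] at hcard
    have := mem_range.1 hi
    omega
  have hsum := sum_le_sum hle
  simp only [sum_add_distrib, sum_const, card_range, smul_eq_mul, mul_one] at hsum
  omega

variable [Fintype V]

/-- Every vertex with an out-neighbour has at least `s` of them. -/
def OutGE (D : V → V → Prop) (s : ℕ) : Prop :=
  open Classical in ∀ u v, D u v → s ≤ #{w | D u w}

theorem OutGE.le_of_cover (hs : OutGE D s) {u v : V} (huv : D u v) (I J : Finset ℕ)
    (h : ∀ w, D u w → (∃ i ∈ I, w = x i) ∨ ∃ j ∈ J, w = y j) : s ≤ #I + #J := by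
  classical
  refine (hs u v huv).trans (card_le_of_cover _ I J fun w hw => h w ?_)
  simpa using hw

theorem AltCycle.two_mul_lt_of_closed (h : AltCycle D a x y) (ha : 0 < a) (hor : IsOriented D)
    (hs : OutGE D s) (hclosed : ∀ i < a, ∀ w, D (x i) w → OnPath a a x y w) :
    2 * s + 1 ≤ 3 * a := by
  classical
  have hle : ∀ i ∈ range a, s ≤ #{j ∈ range a | D (x i) (x j)} + a := by
    intro i hi
    rw [mem_range] at hi
    have := hs.le_of_cover (x := x) (y := y) (h.edge i hi hi)
      {j ∈ range a | D (x i) (x j)} (range a) (by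
        intro w hw
        rcases hclosed i hi w hw with ⟨j, hj, rfl⟩ | ⟨j, hj, rfl⟩
        · exact Or.inl ⟨j, by simp [hj, hw], rfl⟩
        · exact Or.inr ⟨j, by simp [hj], rfl⟩)
    rwa [card_range] at this
  have hsum := sum_le_sum hle
  simp only [sum_add_distrib, sum_const, card_range, smul_eq_mul] at hsum
  have := two_mul_sum_card_add_le (fun i j => D (x i) (x j)) (fun i j => hor _ _) a
  have : a * (2 * s + 1) ≤ a * (3 * a) := by nlinarith
  exact Nat.le_of_mul_le_mul_left this ha

theorem exists_cycle_of_balanced (hor : IsOriented D) (hs : OutGE D s) (ht : OutGE (flip D) t)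
    (ha : 0 < a) (hst : 3 * a ≤ s + t) (h : AltPath D a a x y)
    (hout : ¬ HasAltPath D (a + 1) a) (hin : ¬ HasAltPath (flip D) (a + 1) a) :
    ∃ x' y', AltCycle D a x' y' := by
  classical
  have hx0 : ∀ w, D (x 0) w → OnPath a a x y w := fun w hw => by
    by_contra hc
    exact hin ⟨_, _, h.prepend hc hw⟩
  have hy : ∀ w, D w (y (a - 1)) → OnPath a a x y w := fun w hw => by
    by_contra hc
    exact hout ⟨_, _, h.reverse_balanced.prepend (w := w) (by rwa [onPath_reverse]) hw⟩
  have h1 := hs.le_of_cover (x := x) (y := y) (h.edge 0 ha ha) (Ico 1 a)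
    {j ∈ range a | D (x 0) (y j)} (by
      intro w hw
      rcases hx0 w hw with ⟨j, hj, rfl⟩ | ⟨j, hj, rfl⟩
      · refine Or.inl ⟨j, ?_, rfl⟩
        rw [mem_Ico]
        refine ⟨Nat.one_le_iff_ne_zero.2 ?_, hj⟩
        rintro rfl
        exact hor _ _ hw hw
      · exact Or.inr ⟨j, by simp [hj, hw], rfl⟩)
  have h2 := ht.le_of_cover (x := y) (y := x) (u := y (a - 1)) (v := x (a - 1))
    (h.edge (a - 1) (by omega) (by omega)) (range (a - 1))
    {j ∈ range a | D (x j) (y (a - 1))} (by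
      intro w hw
      rcases hy w hw with ⟨j, hj, rfl⟩ | ⟨j, hj, rfl⟩
      · exact Or.inr ⟨j, by simpa [hj, flip] using hw, rfl⟩
      · refine Or.inl ⟨j, ?_, rfl⟩
        rw [mem_range]
        by_contra hc
        have : j = a - 1 := by omega
        rw [this] at hw
        exact hor _ _ hw hw)
  rw [Nat.card_Ico] at h1
  rw [card_range] at h2
  obtain ⟨i, hi⟩ := inter_nonempty_of_card_lt_card_add_card
    (filter_subset (fun j => D (x 0) (y j)) (range a))
    (filter_subset (fun j => D (x j) (y (a - 1))) (range a)) (by rw [card_range]; omega)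
  rw [mem_inter, mem_filter, mem_filter, mem_range] at hi
  exact h.cycle_of_balanced hi.1.1 hi.1.2 hi.2.2

theorem exists_cycle_of_succ (hor : IsOriented D) (hs : OutGE D s)
    (ha : 0 < a) (h : AltPath D (a + 1) a x y) (hno : ¬ HasAltPath D (a + 1) (a + 1))
    (hst : 3 * a + 1 ≤ 2 * s ∨ (3 * a ≤ 2 * s ∧ ¬ HasAltPath (flip D) (a + 1) a)) :
    ∃ x' y', AltCycle D a x' y' := by
  classical
  have key : ∀ {x y : ℕ → V}, AltPath D (a + 1) a x y →
      s ≤ (a - 1 + if D (x 0) (x a) then 1 else 0) + #{j ∈ range a | D (x 0) (y j)} ∧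
        (D (x 0) (x a) → HasAltPath (flip D) (a + 1) a) := by
    intro x y h
    refine ⟨?_, fun hD => ⟨_, _, (h.truncate (Nat.le_succ a) le_rfl).prepend ?_ hD⟩⟩
    · have hle := hs.le_of_cover (x := x) (y := y) (h.edge 0 (by omega) ha)
        (Ico 1 (a + if D (x 0) (x a) then 1 else 0))
        {j ∈ range a | D (x 0) (y j)} (by
          intro w hw
          have hon : OnPath (a + 1) a x y w := by
            by_contra hc
            exact hno (HasAltPath.flip_balanced ⟨_, _, h.prepend hc hw⟩)
          rcases hon with ⟨j, hj, rfl⟩ | ⟨j, hj, rfl⟩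
          · refine Or.inl ⟨j, ?_, rfl⟩
            have hj0 : j ≠ 0 := by
              rintro rfl
              exact hor _ _ hw hw
            rw [mem_Ico]
            refine ⟨by omega, ?_⟩
            rcases Nat.lt_succ_iff_lt_or_eq.1 hj with hj | rfl
            · omega
            · rw [if_pos hw]
              omega
          · exact Or.inr ⟨j, by simp [hj, hw], rfl⟩)
      rw [Nat.card_Ico] at hle
      omega
    · rintro (⟨j, hj, e⟩ | ⟨j, hj, e⟩)
      · have := h.x_inj a (by omega) j (by omega) e
        omega
      · exact h.x_ne_y a (by omega) j hj e
  obtain ⟨h1, h1'⟩ := key h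
  obtain ⟨h2, h2'⟩ := key h.reverse_succ
  simp only [Nat.sub_zero, Nat.sub_self] at h2 h2'
  have hrefl : #{j ∈ range a | D (x a) (y (a - 1 - j))} =
      #{j ∈ Ico 1 (a + 1) | D (x a) (y (j - 1))} := by
    refine card_bij' (fun j _ => a - j) (fun j _ => a - j) ?_ ?_ ?_ ?_
    · intro j hj
      rw [mem_filter, mem_range] at hj
      rw [mem_filter, mem_Ico, show a - j - 1 = a - 1 - j by omega]
      exact ⟨by omega, hj.2⟩
    · intro j hj
      rw [mem_filter, mem_Ico] at hj
      rw [mem_filter, mem_range, show a - 1 - (a - j) = j - 1 by omega]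
      exact ⟨by omega, hj.2⟩
    · intro j hj
      rw [mem_filter, mem_range] at hj
      omega
    · intro j hj
      rw [mem_filter, mem_Ico] at hj
      omega
  rw [hrefl] at h2
  have hcount : a + 1 < #{j ∈ range a | D (x 0) (y j)} +
      #{j ∈ Ico 1 (a + 1) | D (x a) (y (j - 1))} := by
    have hasymm := hor (x 0) (x a)
    by_cases hc : D (x 0) (x a) <;> by_cases hc' : D (x a) (x 0)
    · exact absurd hc' (hasymm hc)
    · rw [if_pos hc] at h1
      rw [if_neg hc'] at h2
      have := h1' hc
      rcases hst with hst | hst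
      · omega
      · exact absurd this hst.2
    · rw [if_neg hc] at h1
      rw [if_pos hc'] at h2
      have := h2' hc'
      rcases hst with hst | hst
      · omega
      · exact absurd this hst.2
    · rw [if_neg hc] at h1
      rw [if_neg hc'] at h2
      omega
  obtain ⟨i, hi⟩ := inter_nonempty_of_card_lt_card_add_card (s := range (a + 1))
    ((filter_subset (fun j => D (x 0) (y j)) (range a)).trans
      (range_subset_range.2 (Nat.le_succ a)))
    ((filter_subset (fun j => D (x a) (y (j - 1))) (Ico 1 (a + 1))).trans
      (fun j hj => by rw [mem_Ico] at hj; rw [mem_range]; omega)) (by rwa [card_range])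
  rw [mem_inter, mem_filter, mem_filter, mem_range, mem_Ico] at hi
  exact h.cycle_of_succ (by omega) hi.1.1 hi.1.2 hi.2.2

theorem AltCycle.hasAltPath_succ (h : AltCycle D a x y) (ha : 0 < a) (hor : IsOriented D)
    (hs : OutGE D s) (ht : OutGE (flip D) t) (hsa : 3 * a + 1 ≤ 2 * s) (hta : 3 * a ≤ 2 * t) :
    HasAltPath D (a + 1) (a + 1) := by
  classical
  by_contra hno
  have hout : ∃ i < a, ∃ v, D (x i) v ∧ ¬ OnPath a a x y v := by
    by_contra! hc
    have := h.two_mul_lt_of_closed ha hor hs hc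
    omega
  have hin : ∃ i < a, ∃ z, D z (y i) ∧ ¬ OnPath a a x y z := by
    by_contra! hc
    have := h.reverse.two_mul_lt_of_closed ha (isOriented_flip hor) ht
      (fun i hi w hw => onPath_reverse.2 (hc _ (by omega) w hw))
    omega
  obtain ⟨i, hi, v, hv, hvC⟩ := hout
  obtain ⟨j, hj, z, hz, hzC⟩ := hin
  have hvin : ∀ w, D w v → OnPath a a x y w := fun w hw =>
    h.inNeighbor_onPath hor hno hi hv hvC hw
  have hzout : ∀ w, D z w → OnPath a a x y w := fun w hw =>
    onPath_reverse.1 (h.reverse.inNeighbor_onPath (isOriented_flip hor)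
      (fun hc => hno hc.flip_balanced) (i := a - 1 - j) (v := z) (w := w) (by omega)
      (by simpa [flip, show a - 1 - (a - 1 - j) = j by omega] using hz)
      (by rwa [onPath_reverse]) hw)
  have h1 := ht.le_of_cover (x := x) (y := y) (u := v) (v := x i) hv
    {l ∈ range a | D (x l) v} {l ∈ range a | D (y l) v} (by
      intro w hw
      rcases hvin w hw with ⟨l, hl, rfl⟩ | ⟨l, hl, rfl⟩
      · exact Or.inl ⟨l, by simpa [hl, flip] using hw, rfl⟩
      · exact Or.inr ⟨l, by simpa [hl, flip] using hw, rfl⟩)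
  have h2 := hs.le_of_cover (x := x) (y := y) hz
    {l ∈ range a | D z (x l)} {l ∈ range a | D z (y l)} (by
      intro w hw
      rcases hzout w hw with ⟨l, hl, rfl⟩ | ⟨l, hl, rfl⟩
      · exact Or.inl ⟨l, by simpa [hl] using hw, rfl⟩
      · exact Or.inr ⟨l, by simpa [hl] using hw, rfl⟩)
  have hle : ∀ p : ℕ → Prop, #{l ∈ range a | p l} ≤ a := fun p =>
    (card_filter_le _ _).trans_eq (card_range a)
  by_cases hzv : z = v
  · subst hzv
    have hdisj : ∀ f : ℕ → V, #{l ∈ range a | D (f l) z} + #{l ∈ range a | D z (f l)} ≤ a := by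
      intro f
      rw [← card_union_of_disjoint (disjoint_filter.2 fun l _ hl => hor _ _ hl)]
      refine (card_le_card (union_subset (filter_subset _ _) (filter_subset _ _))).trans_eq
        (card_range a)
    have := hdisj x
    have := hdisj y
    omega
  · have := hle (fun l => D (y l) v)
    have := hle (fun l => D z (x l))
    obtain ⟨l, hl⟩ := inter_nonempty_of_card_lt_card_add_card
      (filter_subset (fun l => D (x l) v) (range a))
      (filter_subset (fun l => D z (y l)) (range a)) (by rw [card_range]; omega)
    rw [mem_inter, mem_filter, mem_filter, mem_range] at hl
    exact hno (h.hasAltPath_of_pendant hl.1.1 hl.1.2 hl.2.2 hvC hzC hzv)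

theorem hasAltPath_flip_of_succ (hor : IsOriented D) (hs : OutGE D s) (ha : 0 < a)
    (hsa : 3 * a ≤ 2 * s) (h : HasAltPath D (a + 1) a) : HasAltPath (flip D) (a + 1) a := by
  by_contra hin
  obtain ⟨x, y, h⟩ := h
  obtain ⟨x', y', hC⟩ := exists_cycle_of_succ hor hs ha h (fun hc => hin hc.flip_succ)
    (Or.inr ⟨hsa, hin⟩)
  have := hC.two_mul_lt_of_closed ha hor hs
    (fun i hi w hw => hC.closed_of_not_hasAltPath hin hi hw)
  omega

theorem hasAltPath_succ_or (hor : IsOriented D) (hs : OutGE D s) (ht : OutGE (flip D) t)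
    (ha : 0 < a) (hsa : 3 * a ≤ 2 * s) (hst : 3 * a ≤ s + t) (h : HasAltPath D a a) :
    HasAltPath D (a + 1) a ∨ HasAltPath (flip D) (a + 1) a := by
  by_contra! hc
  obtain ⟨x, y, h⟩ := h
  obtain ⟨x', y', hC⟩ := exists_cycle_of_balanced hor hs ht ha hst h hc.1 hc.2
  have := hC.two_mul_lt_of_closed ha hor hs
    (fun i hi w hw => hC.closed_of_not_hasAltPath hc.2 hi hw)
  omega

theorem hasAltPath_succ_succ (hor : IsOriented D) (hs : OutGE D s) (ht : OutGE (flip D) t)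
    (ha : 0 < a) (hsa : 3 * a + 1 ≤ 2 * s) (hta : 3 * a ≤ 2 * t) (h : HasAltPath D a a) :
    HasAltPath D (a + 1) (a + 1) := by
  by_contra hno
  have hout : HasAltPath D (a + 1) a := by
    rcases hasAltPath_succ_or hor hs ht ha (by omega) (by omega) h with h | h
    · exact h
    · exact hasAltPath_flip_of_succ (isOriented_flip hor) ht ha hta h
  obtain ⟨x, y, h⟩ := hout
  obtain ⟨x', y', hC⟩ := exists_cycle_of_succ hor hs ha h hno (Or.inl hsa)
  exact hno (hC.hasAltPath_succ ha hor hs ht hsa hta)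

theorem hasAltPath_balanced (hor : IsOriented D) (hs : OutGE D s) (ht : OutGE (flip D) t)
    (hD : ∃ u v, D u v) {r : ℕ} (hsr : 3 * r + 1 ≤ 2 * s) (htr : 3 * r ≤ 2 * t) :
    HasAltPath D (r + 1) (r + 1) := by
  induction r with
  | zero =>
    obtain ⟨u, v, huv⟩ := hD
    refine ⟨fun _ => u, fun _ => v, ?_, ?_, ?_, ?_, ?_⟩
    · intros; omega
    · intros; omega
    · rintro - - - - rfl
      exact hor _ _ huv huv
    · intros; exact huv
    · intros; omega
  | succ r ih =>
    exact hasAltPath_succ_succ hor hs ht (by omega) hsr htr (ih (by omega) (by omega))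

theorem hasAltPath_flip_succ (hor : IsOriented D) (hs : OutGE D s) (ht : OutGE (flip D) t)
    (hD : ∃ u v, D u v) {r : ℕ} (hr : 0 < r) (hsr : 3 * r ≤ 2 * s) (htr : 3 * r ≤ 2 * t + 1)
    (hst : 3 * r ≤ s + t) : HasAltPath (flip D) (r + 1) r := by
  obtain ⟨q, rfl⟩ : ∃ q, r = q + 1 := ⟨r - 1, by omega⟩
  have h := hasAltPath_balanced hor hs ht hD (r := q) (by omega) (by omega)
  rcases hasAltPath_succ_or hor hs ht hr hsr hst h with h | h
  · exact hasAltPath_flip_of_succ hor hs hr hsr h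
  · exact h

open Classical in
/-- A digraph with many edges has a nonempty subdigraph with large minimum pseudo-semidegrees;
the out- and in-degree bounds can be traded against each other. -/
theorem exists_subdigraph (D : V → V → Prop) (p q : ℕ)
    (hE : (p + q) * Fintype.card V < 2 * edgeCount D) :
    ∃ D' : V → V → Prop, (∀ u v, D' u v → D u v) ∧ (∃ u v, D' u v) ∧
      OutGE D' (p / 2 + 1) ∧ OutGE (flip D') (q / 2 + 1) := by
  let e : Finset V × Finset V → ℕ := fun P => #{z ∈ P.1 ×ˢ P.2 | D z.1 z.2}
  let good : Finset (Finset V × Finset V) := {P | p * #P.1 + q * #P.2 < 2 * e P}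
  have hgood : ∀ P, P ∈ good ↔ p * #P.1 + q * #P.2 < 2 * e P := fun P => by simp [good]
  have hne : good.Nonempty := by
    refine ⟨(univ, univ), (hgood _).2 ?_⟩
    have : edgeCount D = e (univ, univ) := by
      unfold edgeCount
      rw [Set.ncard_eq_toFinset_card']
      congr 1
      ext z
      simp
    rw [← this, card_univ, ← Nat.add_mul]
    exact hE
  obtain ⟨⟨S, T⟩, hST, hmin⟩ := exists_min_image good (fun P => #P.1 + #P.2) hne
  rw [hgood] at hST
  dsimp only at hST hmin
  refine ⟨fun u v => D u v ∧ u ∈ S ∧ v ∈ T, fun u v h => h.1, ?_, ?_, ?_⟩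
  · have : 0 < e (S, T) := by omega
    obtain ⟨z, hz⟩ := card_pos.1 this
    rw [mem_filter, mem_product] at hz
    exact ⟨z.1, z.2, hz.2, hz.1⟩
  · rintro u v ⟨-, hu, -⟩
    by_contra! hc
    have hcard : e (S, T) ≤ e (S.erase u, T) + #{w | D u w ∧ u ∈ S ∧ w ∈ T} := by
      rw [← card_image_of_injective (f := fun w => (u, w)) _ (Prod.mk_right_injective u)]
      refine (card_le_card ?_).trans (card_union_le _ _)
      rintro ⟨z, w⟩ hz
      simp only [mem_filter, mem_product, mem_union, mem_erase, mem_image, mem_univ, true_and,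
        Prod.mk.injEq] at hz ⊢
      by_cases hzu : z = u
      · subst hzu
        exact Or.inr ⟨w, ⟨hz.2, hz.1⟩, rfl, rfl⟩
      · exact Or.inl ⟨⟨⟨hzu, hz.1.1⟩, hz.1.2⟩, hz.2⟩
    have hS : #(S.erase u) + 1 = #S := card_erase_add_one hu
    have hbad : (S.erase u, T) ∉ good := fun hg => by
      have := hmin _ hg
      dsimp only at this
      omega
    rw [hgood] at hbad
    dsimp only at hbad
    rw [← hS, mul_add] at hST
    omega
  · rintro v u ⟨-, -, hv⟩
    by_contra! hc
    have hcard : e (S, T) ≤ e (S, T.erase v) + #{w | D w v ∧ w ∈ S ∧ v ∈ T} := by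
      rw [← card_image_of_injective (f := fun w => (w, v)) _ (Prod.mk_left_injective v)]
      refine (card_le_card ?_).trans (card_union_le _ _)
      rintro ⟨w, z⟩ hz
      simp only [mem_filter, mem_product, mem_union, mem_erase, mem_image, mem_univ, true_and,
        Prod.mk.injEq] at hz ⊢
      by_cases hzv : z = v
      · subst hzv
        exact Or.inr ⟨w, ⟨hz.2, hz.1⟩, rfl, rfl⟩
      · exact Or.inl ⟨⟨hz.1.1, hzv, hz.1.2⟩, hz.2⟩
    have hT : #(T.erase v) + 1 = #T := card_erase_add_one hv
    have hbad : (S, T.erase v) ∉ good := fun hg => by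
      have := hmin _ hg
      dsimp only at this
      omega
    rw [hgood] at hbad
    dsimp only at hbad
    rw [← hT, mul_add] at hST
    have hflip : #{w | D w v ∧ w ∈ S ∧ v ∈ T} =
        #{w | flip (fun u v => D u v ∧ u ∈ S ∧ v ∈ T) v w} := by
      congr 1
      ext w
      rw [mem_filter, mem_filter]
      rfl
    omega

theorem hasAltPath_balanced_of_edgeCount (hor : IsOriented D) (r : ℕ)
    (hE : (3 * (2 * r + 1) - 4) * Fintype.card V < 2 * edgeCount D) :
    HasAltPath D (r + 1) (r + 1) := by
  obtain ⟨p, q, hpq, hp, hq⟩ : ∃ p q, p + q = 3 * (2 * r + 1) - 4 ∧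
      3 * r + 1 ≤ 2 * (p / 2 + 1) ∧ 3 * r ≤ 2 * (q / 2 + 1) := by
    rcases Nat.eq_zero_or_pos r with rfl | hr
    · exact ⟨0, 0, by omega⟩
    · exact ⟨2 * ((3 * r + 2) / 2 - 1), 2 * ((3 * r + 1) / 2) - 1, by omega⟩
  rw [← hpq] at hE
  obtain ⟨D', hsub, hne, hs, ht⟩ := exists_subdigraph D p q hE
  obtain ⟨x, y, h⟩ := hasAltPath_balanced (fun u v h h' => hor u v (hsub _ _ h) (hsub _ _ h'))
    hs ht hne hp hq
  exact ⟨x, y, h.mono hsub⟩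

theorem hasAltPath_flip_succ_of_edgeCount (hor : IsOriented D) {r : ℕ} (hr : 0 < r)
    (hE : (3 * (2 * r) - 4) * Fintype.card V < 2 * edgeCount D) :
    HasAltPath (flip D) (r + 1) r := by
  obtain ⟨p, q, hpq, hp, hq, hpq'⟩ : ∃ p q, p + q = 3 * (2 * r) - 4 ∧
      3 * r ≤ 2 * (p / 2 + 1) ∧ 3 * r ≤ 2 * (q / 2 + 1) + 1 ∧
      3 * r ≤ (p / 2 + 1) + (q / 2 + 1) :=
    ⟨2 * ((3 * r + 1) / 2 - 1), 2 * (3 * r / 2 - 1), by omega⟩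
  rw [← hpq] at hE
  obtain ⟨D', hsub, hne, hs, ht⟩ := exists_subdigraph D p q hE
  obtain ⟨x, y, h⟩ := hasAltPath_flip_succ
    (fun u v h h' => hor u v (hsub _ _ h) (hsub _ _ h')) hs ht hne hr hp hq hpq'
  exact ⟨x, y, h.mono fun u v => hsub v u⟩

end Counting

theorem AltPath.isAntipath {V : Type*} {D : V → V → Prop} {n m k : ℕ} {x y : ℕ → V}
    (h : AltPath D n m x y) (hn : k / 2 < n) (hm : (k + 1) / 2 ≤ m) :
    IsAntipath D k (fun i => if i % 2 = 0 then x (i / 2) else y (i / 2))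
      (fun i => decide (i % 2 = 0)) := by
  refine ⟨?_, ?_, ?_⟩
  · intro i hi j hj e
    rw [Set.mem_Iic] at hi hj
    dsimp only at e
    split_ifs at e with h1 h2 h2
    · have := h.x_inj _ (by omega) _ (by omega) e
      omega
    · exact absurd e (h.x_ne_y _ (by omega) _ (by omega))
    · exact absurd e.symm (h.x_ne_y _ (by omega) _ (by omega))
    · have := h.y_inj _ (by omega) _ (by omega) e
      omega
  · intro i hi
    by_cases hi2 : i % 2 = 0
    · simp only [hi2, decide_true, if_true, show ¬ (i + 1) % 2 = 0 by omega, if_false,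
        show (i + 1) / 2 = i / 2 by omega]
      exact h.edge _ (by omega) (by omega)
    · simp only [hi2, decide_false, if_false, show (i + 1) % 2 = 0 by omega, if_true,
        show (i + 1) / 2 = i / 2 + 1 by omega, Bool.false_eq_true]
      exact h.edge_succ _ (by omega) (by omega)
  · intro i _ e
    simp only [decide_eq_decide] at e
    omega

theorem IsAntipath.flip {V : Type*} {D : V → V → Prop} {k : ℕ} {f : ℕ → V} {g : ℕ → Bool}
    (h : IsAntipath (flip D) k f g) : IsAntipath D k f (fun i => !g i) := by
  refine ⟨h.1, fun i hi => ?_, fun i hi e => h.2.2 i hi (by simpa using e)⟩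
  have := h.2.1 i hi
  cases hg : g i <;> simpa [hg, _root_.flip] using this

theorem containsAllAntipaths_of_hasAltPath {V : Type*} {D : V → V → Prop} {n m k : ℕ}
    (hn : k / 2 < n) (hm : (k + 1) / 2 ≤ m) (h : HasAltPath D n m)
    (h' : HasAltPath (flip D) n m) : ContainsAllAntipaths D k := by
  rintro (_ | _)
  · obtain ⟨x, y, h'⟩ := h'
    exact ⟨_, _, (h'.isAntipath hn hm).flip, by simp⟩
  · obtain ⟨x, y, h⟩ := h
    exact ⟨_, _, h.isAntipath hn hm, by simp⟩

/-- Theorem 3: for `k ≥ 1`, every oriented graph with more than `(3k-4)·|V(D)|/2`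
edges contains every antidirected path of length `k`. -/
theorem stmt_10 {V : Type*} [Fintype V] (D : V → V → Prop) (hor : IsOriented D)
    (k : ℕ) (hk : 0 < k)
    (hE : (3 * k - 4) * Fintype.card V < 2 * edgeCount D) :
    ContainsAllAntipaths D k := by
  rcases Nat.even_or_odd' k with ⟨r, rfl | rfl⟩
  · exact containsAllAntipaths_of_hasAltPath (n := r + 1) (m := r) (by omega) (by omega)
      (hasAltPath_flip_succ_of_edgeCount (isOriented_flip hor) (by omega)
        (by rwa [edgeCount_flip]))
      (hasAltPath_flip_succ_of_edgeCount hor (by omega) hE)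
  · have h := hasAltPath_balanced_of_edgeCount hor r hE
    exact containsAllAntipaths_of_hasAltPath (by omega) (by omega) h h.flip_balanced
end
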